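/- (Gradient of entropy-of-softmax.) Let C be a finite nonempty index type and define Φ : (C → ℝ) → ℝ by Φ(u) = H(σ(u)). Then Φ is differentiable at every u, and for every i ∈ C its partial derivative is ∂Φ/∂u_i (u) = −σ(u)_i · ( log σ(u)_i + H(σ(u)) ). -/

import Mathlib

open Real Finset

/-- Softmax: `σ(u) c = exp (u c) / ∑ j, exp (u j)`. -/
noncomputable def softmax {C : Type*} [Fintype C] (u : C → ℝ) : C → ℝ :=
  fun c => Real.exp (u c) / ∑ j, Real.exp (u j)

/-- Shannon entropy `H(p) = −∑ c, p c * log (p c)` (natural log, `0 * log 0 = 0`). -/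
noncomputable def entropy {C : Type*} [Fintype C] (p : C → ℝ) : ℝ :=
  -∑ c, p c * Real.log (p c)

/-- The entropy-of-softmax objective `Φ(u) = H(σ(u))` on Euclidean space. -/
noncomputable def entropySoftmax {C : Type*} [Fintype C] (u : EuclideanSpace ℝ C) : ℝ :=
  entropy (softmax u)

theorem sum_exp_pos {C : Type*} [Fintype C] [Nonempty C] (u : C → ℝ) :
    0 < ∑ j, Real.exp (u j) :=
  Finset.sum_pos (fun _ _ => Real.exp_pos _) Finset.univ_nonempty

theorem log_softmax {C : Type*} [Fintype C] [Nonempty C] (u : C → ℝ) (c : C) :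
    Real.log (softmax u c) = u c - Real.log (∑ j, Real.exp (u j)) := by
  rw [softmax, Real.log_div (Real.exp_ne_zero _) (sum_exp_pos u).ne', Real.log_exp]

theorem entropy_softmax {C : Type*} [Fintype C] [Nonempty C] (u : C → ℝ) :
    entropy (softmax u) = Real.log (∑ j, Real.exp (u j)) -
      (∑ j, Real.exp (u j) * u j) / ∑ j, Real.exp (u j) := by
  have hZ := (sum_exp_pos u).ne'
  simp only [entropy, log_softmax, mul_sub, Finset.sum_sub_distrib, ← Finset.sum_mul]
  simp only [softmax, div_mul_eq_mul_div, ← Finset.sum_div]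
  field_simp
  ring

theorem hasFDerivAt_entropySoftmax {C : Type*} [Fintype C] [Nonempty C]
    (u : EuclideanSpace ℝ C) :
    HasFDerivAt entropySoftmax
      (∑ c, (-(softmax u c) * (Real.log (softmax u c) + entropy (softmax u))) •
        (EuclideanSpace.proj c : EuclideanSpace ℝ C →L[ℝ] ℝ)) u := by
  have hZ := (sum_exp_pos u).ne'
  have hproj (c : C) : HasFDerivAt (fun v : EuclideanSpace ℝ C => v c)
      (EuclideanSpace.proj c : EuclideanSpace ℝ C →L[ℝ] ℝ) u :=
    (EuclideanSpace.proj c : EuclideanSpace ℝ C →L[ℝ] ℝ).hasFDerivAt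
  have hsum := HasFDerivAt.fun_sum (u := Finset.univ) fun c _ => (hproj c).exp
  have hsum_mul := HasFDerivAt.fun_sum (u := Finset.univ) fun c _ => (hproj c).exp.mul (hproj c)
  have hfun : (entropySoftmax : EuclideanSpace ℝ C → ℝ) = fun v =>
      Real.log (∑ j, Real.exp (v j)) -
        (∑ j, Real.exp (v j) * v j) * (∑ j, Real.exp (v j))⁻¹ :=
    funext fun v => by rw [entropySoftmax, entropy_softmax, div_eq_mul_inv]
  rw [hfun]
  refine ((hsum.log hZ).sub (hsum_mul.mul
    ((hasDerivAt_inv hZ).comp_hasFDerivAt u hsum))).congr_fderiv ?_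
  ext w
  simp only [log_softmax, entropy_softmax]
  simp [softmax]
  generalize Real.log (∑ j, Real.exp (u j)) = L
  generalize (∑ j, Real.exp (u j) * u j) = S
  generalize (∑ j, Real.exp (u j)) = Z at hZ ⊢
  simp only [Finset.mul_sum, ← Finset.sum_neg_distrib, ← Finset.sum_sub_distrib,
    ← Finset.sum_add_distrib]
  refine Finset.sum_congr rfl fun c _ => ?_
  field_simp
  ring

/-- (Gradient of entropy-of-softmax.)  `Φ(u) = H(σ(u))` is differentiable at every
`u`, and for every `i` its partial derivative (the `i`-th coordinate of its
gradient) is `−σ(u)_i · (log σ(u)_i + H(σ(u)))`. -/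
theorem gradient_entropy_softmax {C : Type*} [Fintype C] [Nonempty C]
    (u : EuclideanSpace ℝ C) :
    DifferentiableAt ℝ entropySoftmax u ∧
    ∀ i : C, gradient entropySoftmax u i =
      -(softmax u i) * (Real.log (softmax u i) + entropy (softmax u)) := by
  classical
  have h := hasFDerivAt_entropySoftmax u
  refine ⟨h.differentiableAt, fun i => ?_⟩
  have hi : inner ℝ (gradient entropySoftmax u) (EuclideanSpace.single i (1 : ℝ)) =
      fderiv ℝ entropySoftmax u (EuclideanSpace.single i 1) := by
    simp [gradient]
  rw [EuclideanSpace.inner_single_right, h.fderiv] at hi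
  simpa [Pi.single_apply] using hi
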